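/- arXiv:1806.03601 — 2 statements merged into one kernel-verified Lean document; each statement's English description precedes it below -/
import Mathlib

section
/- Let A ∈ M(n,ℤ) and let μ be a non-atomic Borel probability measure on 𝕋ⁿ = ℝⁿ/ℤⁿ that is invariant and strongly mixing under the ×A map T_A. Suppose there exist matrices B₁, …, Bₙ ∈ GL(n,ℤ) that are strongly independent over ℤⁿ∖{0} and an infinite set E ⊆ ℕ such that μ is invariant under the ×(Aʲ + Bᵢ) map for every j ∈ E and every i = 1, …, n. Then μ is the Lebesgue (Haar) measure on 𝕋ⁿ. -/
open MeasureTheory Filter Matrix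

noncomputable section

/-- The `n`-torus `ℝⁿ/ℤⁿ`. -/
abbrev Torus (n : ℕ) : Type := Fin n → AddCircle (1 : ℝ)

/-- The `×A` map `T_A : 𝕋ⁿ → 𝕋ⁿ`, `x ↦ A x mod ℤⁿ`. -/
def mulMap {n : ℕ} (A : Matrix (Fin n) (Fin n) ℤ) (x : Torus n) : Torus n :=
  fun i => ∑ j, A i j • x j

/-- The Fourier coefficient `μ̂(k) = ∫ z₁^{k₁} ⋯ zₙ^{kₙ} dμ`. -/
def fourierCoef {n : ℕ} (μ : Measure (Torus n)) (k : Fin n → ℤ) : ℂ :=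
  ∫ x : Torus n, ∏ i, fourier (k i) (x i) ∂μ

/-- A Følner sequence in `ℕ`. -/
def IsFolner (F : ℕ → Finset ℕ) : Prop :=
  ∀ r : ℕ,
    Tendsto (fun m => ((symmDiff ((F m).image (· + r)) (F m)).card : ℝ) / (F m).card)
      atTop (nhds 0)

/-- Matrices `B₁, …, Bₙ` are strongly independent over `ℤⁿ \ {0}` if for every nonzero
row vector `k ∈ ℤⁿ` the row vectors `kB₁, …, kBₙ` are linearly independent over `ℝ`. -/
def StronglyIndependent {n : ℕ} (B : Fin n → Matrix (Fin n) (Fin n) ℤ) : Prop :=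
  ∀ k : Fin n → ℤ, k ≠ 0 →
    LinearIndependent ℝ fun i : Fin n => fun j : Fin n => ((k ᵥ* B i) j : ℝ)

/-- Strong mixing of a map `T` with respect to a measure `μ`. -/
def StronglyMixing {X : Type*} [MeasurableSpace X] (T : X → X) (μ : Measure X) : Prop :=
  ∀ S U : Set X, MeasurableSet S → MeasurableSet U →
    Tendsto (fun j => μ (T^[j] ⁻¹' S ∩ U)) atTop (nhds (μ S * μ U))

/-- The (topological) support of a measure: points all of whose open neighbourhoods have
positive measure; it is the smallest closed set of full measure. -/
def measSupport {X : Type*} [TopologicalSpace X] [MeasurableSpace X] (μ : Measure X) : Set X :=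
  {x | ∀ U : Set X, IsOpen U → x ∈ U → 0 < μ U}

/-- A uniformly Lipschitz sequence of additive functionals on `L¹` which tends to zero on
indicators of measurable sets tends to zero everywhere. -/
lemma tendsto_zero_of_forall_indicator {X : Type*} [MeasurableSpace X] {μ : Measure X}
    {Φ : ℕ → (X → ℂ) → ℂ} (C : NNReal)
    (hadd : ∀ j f g, Integrable f μ → Integrable g μ → Φ j (f + g) = Φ j f + Φ j g)
    (hlip : ∀ j f g, Integrable f μ → Integrable g μ →
      ‖Φ j f - Φ j g‖ ≤ C * ∫ x, ‖f x - g x‖ ∂μ)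
    (hind : ∀ (c : ℂ) (S : Set X), MeasurableSet S →
      Tendsto (fun j => Φ j (S.indicator fun _ => c)) atTop (nhds 0))
    {f : X → ℂ} (hf : Integrable f μ) :
    Tendsto (fun j => Φ j f) atTop (nhds 0) := by
  refine Integrable.induction
    (P := fun f => Tendsto (fun j => Φ j f) atTop (nhds 0)) ?_ ?_ ?_ ?_ hf
  · exact fun c S hS _ => hind c S hS
  · intro f g _ hf hg h1 h2
    simpa [hadd _ f g hf hg] using h1.add h2
  · have hL : ∀ j, LipschitzWith C fun f : X →₁[μ] ℂ => Φ j f := fun j =>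
      LipschitzWith.of_dist_le_mul fun f g => by
        rw [dist_eq_norm, L1.dist_eq_integral_dist]
        simpa only [dist_eq_norm] using
          hlip j f g (L1.integrable_coeFn f) (L1.integrable_coeFn g)
    exact (LipschitzWith.uniformEquicontinuous _ C hL).equicontinuous.isClosed_setOfPred_tendsto
      continuous_const
  · intro f g hfg hf h1
    have hg := hf.congr hfg
    refine h1.congr fun j => ?_
    have h0 : ∫ x, ‖f x - g x‖ ∂μ = 0 := by
      refine integral_eq_zero_of_ae ?_
      filter_upwards [hfg] with x hx
      simp [hx]
    have := hlip j f g hf hg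
    rw [h0, mul_zero] at this
    exact sub_eq_zero.1 (norm_le_zero_iff.1 this)

lemma norm_integral_mul_le_of_bound {X : Type*} [MeasurableSpace X] {μ : Measure X} {f g : X → ℂ}
    {C : ℝ} (hfC : ∀ x, ‖f x‖ ≤ C) (hg : Integrable g μ) :
    ‖∫ x, f x * g x ∂μ‖ ≤ C * ∫ x, ‖g x‖ ∂μ := by
  rw [← integral_const_mul]
  refine norm_integral_le_of_norm_le (hg.norm.const_mul C) (.of_forall fun x => ?_)
  rw [norm_mul]
  exact mul_le_mul_of_nonneg_right (hfC x) (norm_nonneg _)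

/-- The sequence of correlations of two functions under a strongly mixing map, with one function
an indicator. -/
lemma StronglyMixing.tendsto_integral_indicator_mul {X : Type*} [MeasurableSpace X]
    {T : X → X} {μ : Measure X} [IsProbabilityMeasure μ] (hT : Measurable T)
    (h : StronglyMixing T μ) (c : ℂ) {S : Set X} (hS : MeasurableSet S) {g : X → ℂ}
    (hg : Integrable g μ) :
    Tendsto (fun j => ∫ x, S.indicator (fun _ => c) (T^[j] x) * g x ∂μ) atTop
      (nhds ((∫ x, S.indicator (fun _ => c) x ∂μ) * ∫ x, g x ∂μ)) := by
  have hb : ∀ x, ‖S.indicator (fun _ => c) x‖ ≤ ‖c‖ := fun x => norm_indicator_le_norm_self _ _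
  have hm : Measurable (S.indicator fun _ => c) := measurable_const.indicator hS
  have hint : ∀ j (g : X → ℂ), Integrable g μ →
      Integrable (fun x => S.indicator (fun _ => c) (T^[j] x) * g x) μ := fun j g hg =>
    hg.bdd_mul (hm.comp (hT.iterate j)).aestronglyMeasurable (.of_forall fun x => hb _)
  rw [← tendsto_sub_nhds_zero_iff]
  refine tendsto_zero_of_forall_indicator (μ := μ) (Φ := fun j g =>
    ∫ x, S.indicator (fun _ => c) (T^[j] x) * g x ∂μ -
      (∫ x, S.indicator (fun _ => c) x ∂μ) * ∫ x, g x ∂μ) (2 * ‖c‖₊) ?_ ?_ ?_ hg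
  · intro j f g hf hg
    simp only [Pi.add_apply, mul_add]
    rw [integral_add (hint j f hf) (hint j g hg), integral_add hf hg]
    ring
  · intro j f g hf hg
    have h1 := norm_integral_mul_le_of_bound (f := fun x => S.indicator (fun _ => c) (T^[j] x))
      (g := fun x => f x - g x) (μ := μ) (fun x => hb _) (hf.sub hg)
    have h2 := norm_integral_mul_le_of_bound (f := fun _ => ∫ x, S.indicator (fun _ => c) x ∂μ)
      (g := fun x => f x - g x) (μ := μ) (C := ‖c‖)
      (fun _ => by simpa using norm_integral_le_of_norm_le_const (μ := μ) (.of_forall hb))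
      (hf.sub hg)
    simp only [mul_sub] at h1 h2
    rw [integral_sub (hint j f hf) (hint j g hg)] at h1
    rw [integral_sub (hf.const_mul _) (hg.const_mul _), integral_const_mul,
      integral_const_mul] at h2
    push_cast
    rw [two_mul, add_mul]
    refine le_trans (le_of_eq_of_le ?_ (norm_sub_le _ _)) (add_le_add h1 h2)
    congr 1
    ring
  · intro d U hU
    have key := h S U hS hU
    have hr : Tendsto (fun j => μ.real (T^[j] ⁻¹' S ∩ U)) atTop (nhds (μ.real S * μ.real U)) := by
      simp only [Measure.real, ← ENNReal.toReal_mul]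
      exact (ENNReal.tendsto_toReal (by finiteness)).comp key
    have hc : Tendsto (fun j => (μ.real (T^[j] ⁻¹' S ∩ U) : ℂ)) atTop
        (nhds ((μ.real S * μ.real U : ℝ) : ℂ)) :=
      (Complex.continuous_ofReal.tendsto _).comp hr
    rw [tendsto_sub_nhds_zero_iff]
    convert hc.mul_const (c * d) using 1
    · funext j
      have : (fun x => S.indicator (fun _ => c) (T^[j] x) * U.indicator (fun _ => d) x) =
          (T^[j] ⁻¹' S ∩ U).indicator fun _ => c * d := by
        funext x
        by_cases h1 : T^[j] x ∈ S <;> by_cases h2 : x ∈ U <;> simp [h1, h2]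
      rw [this, integral_indicator_const _ ((hT.iterate j hS).inter hU)]
      simp
    · rw [integral_indicator_const _ hS, integral_indicator_const _ hU]
      simp
      ring_nf

/-- Decay of correlations for a strongly mixing measure-preserving map. -/
lemma StronglyMixing.tendsto_integral_mul {X : Type*} [MeasurableSpace X]
    {T : X → X} {μ : Measure X} [IsProbabilityMeasure μ] (hT : MeasurePreserving T μ μ)
    (h : StronglyMixing T μ) {f g : X → ℂ} (hf : Integrable f μ)
    (hgm : AEStronglyMeasurable g μ) {C : NNReal} (hgC : ∀ x, ‖g x‖ ≤ C) :
    Tendsto (fun j => ∫ x, f (T^[j] x) * g x ∂μ) atTop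
      (nhds ((∫ x, f x ∂μ) * ∫ x, g x ∂μ)) := by
  have hg : Integrable g μ := .of_bound hgm C (.of_forall hgC)
  have hcomp : ∀ j (f : X → ℂ), Integrable f μ → Integrable (fun x => f (T^[j] x)) μ :=
    fun j f hf => (hT.iterate j).integrable_comp_of_integrable hf
  have hint : ∀ j (f : X → ℂ), Integrable f μ → Integrable (fun x => g x * f (T^[j] x)) μ :=
    fun j f hf => (hcomp j f hf).bdd_mul hgm (.of_forall hgC)
  simp only [mul_comm _ (g _)]
  rw [← tendsto_sub_nhds_zero_iff]
  refine tendsto_zero_of_forall_indicator (μ := μ) (Φ := fun j f =>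
    ∫ x, g x * f (T^[j] x) ∂μ - (∫ x, f x ∂μ) * ∫ x, g x ∂μ) (2 * C) ?_ ?_ ?_ hf
  · intro j f f' hf hf'
    simp only [Pi.add_apply, mul_add]
    rw [integral_add (hint j f hf) (hint j f' hf'), integral_add hf hf']
    ring
  · intro j f f' hf hf'
    have h1 := norm_integral_mul_le_of_bound (μ := μ) hgC
      ((hcomp j f hf).sub (hcomp j f' hf'))
    have h2 := norm_integral_mul_le_of_bound (f := fun _ => ∫ x, g x ∂μ)
      (g := fun x => f x - f' x) (μ := μ) (C := C)
      (fun _ => by simpa using norm_integral_le_of_norm_le_const (μ := μ) (.of_forall hgC))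
      (hf.sub hf')
    have h3 : ∫ x, ‖f (T^[j] x) - f' (T^[j] x)‖ ∂μ = ∫ x, ‖f x - f' x‖ ∂μ := by
      have hmap := (hT.iterate j).map_eq
      conv_rhs => rw [← hmap]
      rw [integral_map (hT.iterate j).measurable.aemeasurable]
      rw [hmap]
      exact (hf.sub hf').norm.aestronglyMeasurable
    simp only [mul_sub, Pi.sub_apply] at h1 h2
    rw [integral_sub (hint j f hf) (hint j f' hf'), h3] at h1
    rw [integral_sub (hf.const_mul _) (hf'.const_mul _), integral_const_mul,
      integral_const_mul] at h2
    push_cast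
    rw [two_mul, add_mul]
    refine le_trans (le_of_eq_of_le ?_ (norm_sub_le _ _)) (add_le_add h1 h2)
    congr 1
    ring
  · intro c S hS
    rw [tendsto_sub_nhds_zero_iff]
    simpa only [mul_comm (g _)] using h.tendsto_integral_indicator_mul hT.measurable c hS hg

lemma continuous_mulMap {n : ℕ} (A : Matrix (Fin n) (Fin n) ℤ) : Continuous (mulMap A) := by
  unfold mulMap
  fun_prop

lemma mulMap_one {n : ℕ} : mulMap (1 : Matrix (Fin n) (Fin n) ℤ) = id := by
  funext x i
  simp [mulMap, Matrix.one_apply, ite_smul]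

lemma mulMap_mul {n : ℕ} (A B : Matrix (Fin n) (Fin n) ℤ) :
    mulMap (A * B) = mulMap A ∘ mulMap B := by
  funext x i
  simp only [mulMap, Matrix.mul_apply, Function.comp_apply, Finset.sum_smul, Finset.smul_sum,
    mul_smul]
  exact Finset.sum_comm

lemma mulMap_pow {n : ℕ} (A : Matrix (Fin n) (Fin n) ℤ) (j : ℕ) :
    mulMap (A ^ j) = (mulMap A)^[j] := by
  induction j with
  | zero => simp [mulMap_one]
  | succ j ih => rw [pow_succ, mulMap_mul, ih, Function.iterate_succ]

open UnitAddTorus in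
lemma mFourier_eq_toCircle {d : Type*} [Fintype d] (k : d → ℤ) (x : UnitAddTorus d) :
    mFourier k x = AddCircle.toCircle (∑ i, k i • x i) := by
  have hsum : ∀ s : Finset d, ∏ i ∈ s, (AddCircle.toCircle (k i • x i) : ℂ) =
      AddCircle.toCircle (∑ i ∈ s, k i • x i) := by
    intro s
    classical
    induction s using Finset.induction_on with
    | empty => simp
    | insert a s ha ih => simp [ha, ih, AddCircle.toCircle_add]
  simpa [mFourier, fourier_apply] using hsum Finset.univ

open UnitAddTorus in
lemma mFourier_mulMap {n : ℕ} (A : Matrix (Fin n) (Fin n) ℤ) (k : Fin n → ℤ) (x : Torus n) :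
    mFourier k (mulMap A x) = mFourier (k ᵥ* A) x := by
  rw [mFourier_eq_toCircle, mFourier_eq_toCircle]
  congr 2
  simp only [mulMap, Matrix.vecMul, dotProduct, Finset.sum_smul, Finset.smul_sum, mul_smul]
  exact Finset.sum_comm

open UnitAddTorus in
lemma norm_mFourier_apply {d : Type*} [Fintype d] (k : d → ℤ) (x : UnitAddTorus d) :
    ‖mFourier k x‖ = 1 := by
  rw [mFourier_eq_toCircle, Circle.norm_coe]

open UnitAddTorus in
lemma integrable_mFourier {d : Type*} [Fintype d] (μ : Measure (UnitAddTorus d))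
    [IsFiniteMeasure μ] (k : d → ℤ) : Integrable (mFourier k) μ :=
  .of_bound (mFourier k).continuous.aestronglyMeasurable 1
    (.of_forall fun x => (norm_mFourier_apply k x).le)

/-- A probability measure on the torus whose nontrivial Fourier coefficients vanish is
the Haar measure. -/
lemma eq_volume_of_integral_mFourier_eq_zero {d : Type*} [Fintype d]
    (μ : Measure (UnitAddTorus d)) [IsProbabilityMeasure μ]
    (h : ∀ k : d → ℤ, k ≠ 0 → ∫ x, UnitAddTorus.mFourier k x ∂μ = 0) : μ = volume := by
  have : IsProbabilityMeasure (volume : Measure (UnitAddTorus d)) :=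
    ⟨by simp [volume_pi, Measure.pi_univ, AddCircle.measure_univ]⟩
  have hvol : ∀ k : d → ℤ, k ≠ 0 → ∫ x, UnitAddTorus.mFourier k x = 0 := by
    intro k hk
    obtain ⟨i, hi⟩ := Function.ne_iff.mp hk
    simp only [UnitAddTorus.mFourier, ContinuousMap.coe_mk]
    rw [integral_fintype_prod_volume_eq_prod]
    refine Finset.prod_eq_zero (Finset.mem_univ i) ?_
    exact integral_eq_zero_of_add_right_eq_neg (fourier_add_half_inv_index hi one_pos)
  refine ext_of_forall_mem_subalgebra_integral_eq_of_polish (𝕜 := ℂ)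
    (A := (UnitAddTorus.mFourierSubalgebra d).comap
      (BoundedContinuousFunction.toContinuousMapStarₐ ℂ)) ?_ fun g hg => ?_
  · intro x y hxy
    obtain ⟨_, ⟨f, hf, rfl⟩, hne⟩ := UnitAddTorus.mFourierSubalgebra_separatesPoints hxy
    exact ⟨f, ⟨f, ⟨.mkOfCompact f, hf, rfl⟩, rfl⟩, hne⟩
  · have hspan : g.toContinuousMap ∈
        Submodule.span ℂ (Set.range (UnitAddTorus.mFourier (d := d))) := by
      rw [← UnitAddTorus.mFourierSubalgebra_coe]
      exact hg
    have hint : ∀ (f : C(UnitAddTorus d, ℂ)) (ν : Measure (UnitAddTorus d))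
        [IsProbabilityMeasure ν], Integrable f ν := fun f ν _ =>
      .of_bound f.continuous.aestronglyMeasurable ‖f‖ (.of_forall f.norm_coe_le_norm)
    change ∫ x, g.toContinuousMap x ∂μ = ∫ x, g.toContinuousMap x
    clear hg
    generalize g.toContinuousMap = f at hspan
    induction hspan using Submodule.span_induction with
    | mem f hf =>
      obtain ⟨k, rfl⟩ := hf
      by_cases hk : k = 0
      · simp [hk, UnitAddTorus.mFourier_zero]
      · rw [h k hk, hvol k hk]
    | zero => simp
    | add f f' _ _ h1 h2 =>
      simp only [ContinuousMap.add_apply]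
      rw [integral_add (hint f μ) (hint f' μ), integral_add (hint f _) (hint f' _), h1, h2]
    | smul c f _ h1 =>
      simp only [ContinuousMap.smul_apply]
      rw [integral_smul, integral_smul, h1]

/-- If the average of a character is `1`, then it is trivial almost everywhere. -/
lemma ae_sum_smul_eq_zero_of_integral_mFourier_eq_one {d : Type*} [Fintype d]
    (μ : Measure (UnitAddTorus d)) [IsProbabilityMeasure μ] {k : d → ℤ}
    (h : ∫ x, UnitAddTorus.mFourier k x ∂μ = 1) : ∀ᵐ x ∂μ, ∑ i, k i • x i = 0 := by
  have hi := integrable_mFourier μ k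
  have hre : ∫ x, (1 - (UnitAddTorus.mFourier k x).re) ∂μ = 0 := by
    have h1 : ∫ x, (UnitAddTorus.mFourier k x).re ∂μ = 1 := by
      have := integral_re hi
      simp only [RCLike.re_to_complex] at this
      rw [this, h, Complex.one_re]
    rw [integral_sub (integrable_const _) (by simpa using hi.re), h1]
    simp
  have hnn : ∀ x, 0 ≤ 1 - (UnitAddTorus.mFourier k x).re := fun x =>
    sub_nonneg.2 ((Complex.re_le_norm _).trans (norm_mFourier_apply k x).le)
  rw [integral_eq_zero_iff_of_nonneg hnn ((integrable_const _).sub hi.re)] at hre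
  filter_upwards [hre] with x hx
  have hx1 : (UnitAddTorus.mFourier k x).re = 1 := (sub_eq_zero.1 hx).symm
  have hx2 : UnitAddTorus.mFourier k x = 1 := by
    have hn := norm_mFourier_apply k x
    have := Complex.sq_norm_sub_sq_re (UnitAddTorus.mFourier k x)
    rw [hn, hx1] at this
    refine Complex.ext hx1 ?_
    simpa using this.symm
  rw [mFourier_eq_toCircle] at hx2
  refine AddCircle.injective_toCircle one_ne_zero ?_
  rw [AddCircle.toCircle_zero]
  exact Circle.ext hx2

/-- The common kernel of the characters given by the rows of a nonsingular matrix is finite. -/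
lemma finite_setOf_mulMap_eq_zero {n : ℕ} {M : Matrix (Fin n) (Fin n) ℤ} (hM : M.det ≠ 0) :
    {x : Torus n | mulMap M x = 0}.Finite := by
  have hfin : {u : AddCircle (1 : ℝ) | M.det • u = 0}.Finite := by
    refine (AddCircle.finite_torsion 1 (Int.natAbs_pos.2 hM)).subset fun u hu => ?_
    change M.det.natAbs • u = 0
    exact natAbs_nsmul_eq_zero.2 hu
  refine (Set.Finite.pi' fun _ : Fin n => hfin).subset fun x hx i => ?_
  have h1 : mulMap (M.adjugate * M) x = 0 := by
    rw [mulMap_mul, Function.comp_apply, show mulMap M x = 0 from hx]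
    funext i
    simp [mulMap]
  rw [Matrix.adjugate_mul] at h1
  simpa [mulMap, Matrix.smul_apply, Matrix.one_apply, ite_smul] using congrFun h1 i

lemma det_ne_zero_of_linearIndependent_intCast {n : ℕ} {M : Matrix (Fin n) (Fin n) ℤ}
    (h : LinearIndependent ℝ fun i j => (M i j : ℝ)) : M.det ≠ 0 := by
  have hu : IsUnit (M.map (Int.cast : ℤ → ℝ)) := Matrix.linearIndependent_rows_iff_isUnit.1 h
  rw [Matrix.isUnit_iff_isUnit_det, isUnit_iff_ne_zero] at hu
  intro h0
  apply hu
  have := Int.cast_det (R := ℝ) M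
  rw [← this, h0, Int.cast_zero]

theorem stmt2 {n : ℕ} (hn : 0 < n) (A : Matrix (Fin n) (Fin n) ℤ)
    (μ : Measure (Torus n)) [IsProbabilityMeasure μ]
    (hna : ∀ x : Torus n, μ {x} = 0)
    (hinvA : Measure.map (mulMap A) μ = μ)
    (hsm : StronglyMixing (mulMap A) μ)
    (B : Fin n → Matrix (Fin n) (Fin n) ℤ)
    (hBGL : ∀ i, IsUnit (B i).det)
    (hSI : StronglyIndependent B)
    (E : Set ℕ) (hE : E.Infinite)
    (hinv : ∀ j ∈ E, ∀ i : Fin n, Measure.map (mulMap (A ^ j + B i)) μ = μ) :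
    μ = volume := by
  have hT : MeasurePreserving (mulMap A) μ μ := ⟨(continuous_mulMap A).measurable, hinvA⟩
  refine eq_volume_of_integral_mFourier_eq_zero μ fun k hk => ?_
  by_contra hne
  have hone : ∀ i, ∫ x, UnitAddTorus.mFourier (k ᵥ* B i) x ∂μ = 1 := by
    intro i
    have hlim := hsm.tendsto_integral_mul hT (integrable_mFourier μ k)
      (integrable_mFourier μ (k ᵥ* B i)).aestronglyMeasurable (C := 1)
      (fun x => (norm_mFourier_apply _ x).le)
    have hfreq : ∃ᶠ j in atTop, ∫ x, UnitAddTorus.mFourier k ((mulMap A)^[j] x) *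
        UnitAddTorus.mFourier (k ᵥ* B i) x ∂μ = ∫ x, UnitAddTorus.mFourier k x ∂μ := by
      refine (Nat.frequently_atTop_iff_infinite.2 hE).mono fun j hj => ?_
      conv_rhs => rw [← hinv j hj i]
      rw [integral_map (continuous_mulMap _).aemeasurable
        (UnitAddTorus.mFourier k).continuous.aestronglyMeasurable]
      refine integral_congr_ae (.of_forall fun x => ?_)
      simp only [← mulMap_pow, mFourier_mulMap, Matrix.vecMul_add, UnitAddTorus.mFourier_add]
    have heq : (∫ x, UnitAddTorus.mFourier k x ∂μ) *
        ∫ x, UnitAddTorus.mFourier (k ᵥ* B i) x ∂μ = ∫ x, UnitAddTorus.mFourier k x ∂μ :=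
      isClosed_singleton.mem_of_frequently_of_tendsto hfreq hlim
    exact mul_left_cancel₀ hne (by rw [heq, mul_one])
  have hdet := det_ne_zero_of_linearIndependent_intCast (M := .of fun i => k ᵥ* B i) (hSI k hk)
  have : NullSingletonClass μ := ⟨hna⟩
  have hzero := (finite_setOf_mulMap_eq_zero hdet).measure_zero μ
  have hae : ∀ᵐ x ∂μ, mulMap (.of fun i => k ᵥ* B i) x = 0 := by
    filter_upwards [ae_all_iff.2 fun i =>
      ae_sum_smul_eq_zero_of_integral_mFourier_eq_one μ (hone i)] with x hx
    exact funext hx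
  have h0 : ∀ᵐ x ∂μ, ¬ mulMap (.of fun i => k ᵥ* B i) x = 0 := by
    rw [ae_iff]
    simpa using hzero
  obtain ⟨x, hx, hx'⟩ := (hae.and h0).exists
  exact hx' hx
end
end

section
/- Let n be a positive integer with n ≡ 1 (mod 3). Then 1 is a root of the characteristic polynomial of the n×n matrix M_n(2) (diagonal entries (2, 2, …, 2, 1), entries 1 on the super- and subdiagonal, 0 elsewhere), and 1 is its only rational root. -/
open Matrix Polynomial

noncomputable section

/-- The `n × n` real tridiagonal matrix `M_n(a)` with diagonal `(a, a, …, a, a-1)`,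
entries `1` on the super- and subdiagonal, and `0` elsewhere. -/
def Mmat (n : ℕ) (a : ℝ) : Matrix (Fin n) (Fin n) ℝ :=
  Matrix.of fun i j =>
    if (i : ℕ) = (j : ℕ) then (if (i : ℕ) = n - 1 then a - 1 else a)
    else if (i : ℕ) + 1 = (j : ℕ) ∨ (j : ℕ) + 1 = (i : ℕ) then 1 else 0

/-- The `n × n` real tridiagonal matrix `N_n(a)` with all diagonal entries `a`,
entries `1` on the super- and subdiagonal, and `0` elsewhere. -/
def Nmat (n : ℕ) (a : ℝ) : Matrix (Fin n) (Fin n) ℝ :=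
  Matrix.of fun i j =>
    if (i : ℕ) = (j : ℕ) then a
    else if (i : ℕ) + 1 = (j : ℕ) ∨ (j : ℕ) + 1 = (i : ℕ) then 1 else 0

/-- The integer matrix `M_n(2)`: tridiagonal with diagonal `(2, …, 2, 1)` and `1` on the
super- and subdiagonal. -/
def MmatInt (n : ℕ) : Matrix (Fin n) (Fin n) ℤ :=
  Matrix.of fun i j =>
    if (i : ℕ) = (j : ℕ) then (if (i : ℕ) = n - 1 then 1 else 2)
    else if (i : ℕ) + 1 = (j : ℕ) ∨ (j : ℕ) + 1 = (i : ℕ) then 1 else 0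

/-- The Lucas sequence `u₀ = 0`, `u₁ = 1`, `uₖ₊₂ = t uₖ₊₁ - uₖ`. -/
def lucasSeq {R : Type*} [CommRing R] (t : R) : ℕ → R
  | 0 => 0
  | 1 => 1
  | k + 2 => t * lucasSeq t (k + 1) - lucasSeq t k

lemma lucasSeq_intCast (t : ℤ) (k : ℕ) : lucasSeq (t : ℝ) k = (lucasSeq t k : ℤ) := by
  induction k using Nat.twoStepInduction with
  | zero => simp [lucasSeq]
  | one => simp [lucasSeq]
  | more k h₀ h₁ => simp [lucasSeq, h₀, h₁]

lemma lucasSeq_modEq (x : ℤ) (k : ℕ) :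
    lucasSeq (x - 2) k ≡ (-1) ^ (k + 1) * k [ZMOD x] := by
  induction k using Nat.twoStepInduction with
  | zero => simp [lucasSeq]
  | one => simp [lucasSeq]
  | more k h₀ h₁ =>
    have hx : x - 2 ≡ -2 [ZMOD x] := by
      rw [Int.modEq_iff_dvd]
      exact ⟨-1, by ring⟩
    refine ((hx.mul h₁).sub h₀).trans ?_
    rw [show (-2 : ℤ) * ((-1) ^ (k + 1 + 1) * ((k + 1 : ℕ) : ℤ)) - (-1) ^ (k + 1) * k
      = (-1) ^ (k + 2 + 1) * ((k + 2 : ℕ) : ℤ) by push_cast; ring]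

lemma lucasSeq_neg_one (k : ℕ) :
    lucasSeq (-1 : ℤ) (3 * k) = 0 ∧ lucasSeq (-1 : ℤ) (3 * k + 1) = 1 := by
  induction k with
  | zero => simp [lucasSeq]
  | succ k ih =>
    rw [show 3 * (k + 1) = 3 * k + 3 by ring]
    simp [lucasSeq, ih.1, ih.2]

lemma lucasSeq_neg_three (k : ℕ) :
    0 < (-1) ^ k * (lucasSeq (-3 : ℤ) (k + 1) + lucasSeq (-3 : ℤ) k) ∧
      0 ≤ (-1) ^ (k + 1) * lucasSeq (-3 : ℤ) k := by
  induction k with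
  | zero => simp [lucasSeq]
  | succ k ih =>
    simp only [lucasSeq, pow_succ] at ih ⊢
    constructor <;> linarith [ih.1, ih.2]

lemma eq_one_of_lucasSeq_add_eq_zero {n : ℕ} {x : ℤ}
    (h : lucasSeq (x - 2) (n + 1) + lucasSeq (x - 2) n = 0) : x = 1 := by
  have hmod := (lucasSeq_modEq x (n + 1)).add (lucasSeq_modEq x n)
  rw [h, show (-1 : ℤ) ^ (n + 1 + 1) * ((n + 1 : ℕ) : ℤ) + (-1) ^ (n + 1) * n = (-1) ^ n by
    push_cast; ring, Int.modEq_iff_dvd, sub_zero] at hmod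
  have hu : IsUnit x := isUnit_of_dvd_unit hmod (isUnit_neg_one.pow n)
  rcases Int.isUnit_iff.mp hu with rfl | rfl
  · rfl
  · have := (lucasSeq_neg_three n).1
    norm_num at h
    simp [h] at this

lemma Mmat_mulVec (n : ℕ) (a : ℝ) (w : ℕ → ℝ) (hw : w 0 = 0) (i : Fin n) :
    (Mmat n a *ᵥ fun j => w (j + 1)) i =
      w i + a * w (i + 1) + if (i : ℕ) + 1 < n then w (i + 2) else -w (i + 1) := by
  have hi := i.isLt
  have hentry (j : Fin n) : Mmat n a i j * w (j + 1) =
      (if (j : ℕ) = i then (if (i : ℕ) + 1 < n then a else a - 1) * w (i + 1) else 0) +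
      (if (j : ℕ) = i + 1 then w (i + 2) else 0) +
      (if (j : ℕ) + 1 = i then w i else 0) := by
    simp only [Mmat, Matrix.of_apply]
    grind
  simp only [mulVec, dotProduct, hentry]
  rw [Fin.sum_univ_eq_sum_range (fun j =>
      (if j = (i : ℕ) then (if (i : ℕ) + 1 < n then a else a - 1) * w (i + 1) else 0) +
      (if j = (i : ℕ) + 1 then w (i + 2) else 0) +
      (if j + 1 = (i : ℕ) then w i else 0)) n]
  have hlow : ∑ j ∈ Finset.range n, (if j + 1 = (i : ℕ) then w i else 0) = w i := by
    rcases Nat.eq_zero_or_pos (i : ℕ) with h0 | h0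
    · simp [h0, hw]
    · rw [Finset.sum_eq_single ((i : ℕ) - 1)]
      · simp [Nat.sub_add_cancel h0]
      · intro j _ hj
        exact if_neg (by omega)
      · intro h
        exact absurd (Finset.mem_range.mpr (by omega)) h
  rw [Finset.sum_add_distrib, Finset.sum_add_distrib, hlow, Finset.sum_ite_eq',
    Finset.sum_ite_eq']
  simp only [Finset.mem_range, hi, if_true]
  split_ifs <;> ring

lemma Mmat_charpoly_isRoot_iff_exists (n : ℕ) (a x : ℝ) :
    (Mmat n a).charpoly.IsRoot x ↔ ∃ v ≠ 0, Mmat n a *ᵥ v = x • v := by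
  rw [IsRoot, Matrix.eval_charpoly, ← Matrix.exists_mulVec_eq_zero_iff]
  simp only [sub_mulVec, sub_eq_zero, scalar_apply, ← smul_one_eq_diagonal, smul_mulVec,
    one_mulVec, eq_comm]

lemma Mmat_charpoly_isRoot_iff {n : ℕ} (hn : 0 < n) (a x : ℝ) :
    (Mmat n a).charpoly.IsRoot x ↔ lucasSeq (x - a) (n + 1) + lucasSeq (x - a) n = 0 := by
  rw [Mmat_charpoly_isRoot_iff_exists]
  constructor
  · rintro ⟨v, hv, hev⟩
    let w : ℕ → ℝ := fun k => if h : 0 < k ∧ k - 1 < n then v ⟨k - 1, h.2⟩ else 0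
    have hw0 : w 0 = 0 := by simp [w]
    have hwv : (fun j : Fin n => w (j + 1)) = v := by
      ext j
      simp [w]
    have hrow (i : Fin n) := Mmat_mulVec n a w hw0 i
    simp only [hwv, hev, ← congrFun hwv, Pi.smul_apply, smul_eq_mul] at hrow
    have hwu (k : ℕ) : k ≤ n → w k = lucasSeq (x - a) k * w 1 := by
      induction k using Nat.twoStepInduction with
      | zero => simp [lucasSeq, hw0]
      | one => simp [lucasSeq]
      | more k h₀ h₁ =>
        intro hk
        have h := hrow ⟨k, by omega⟩
        simp only [if_pos (show k + 1 < n by omega), h₀ (by omega), h₁ (by omega)] at h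
        simp only [lucasSeq]
        linarith
    have hw1 : w 1 ≠ 0 := by
      intro h1
      refine hv ?_
      ext j
      rw [← hwv]
      simp [hwu (j + 1) j.isLt, h1]
    obtain ⟨m, rfl⟩ : ∃ m, n = m + 1 := ⟨n - 1, by omega⟩
    have h := hrow ⟨m, by omega⟩
    simp only [lt_irrefl, if_false, hwu m (by omega), hwu (m + 1) le_rfl] at h
    refine (mul_eq_zero.mp ?_).resolve_right hw1
    simp only [lucasSeq]
    linarith
  · intro h
    refine ⟨fun j => lucasSeq (x - a) (j + 1), fun h0 => ?_, ?_⟩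
    · simpa [lucasSeq] using congrFun h0 ⟨0, hn⟩
    · ext i
      rw [Mmat_mulVec n a _ rfl]
      simp only [Pi.smul_apply, smul_eq_mul]
      split_ifs with hi
      · simp only [lucasSeq]
        ring
      · have hni : n = i + 1 := by omega
        rw [hni] at h
        simp only [lucasSeq] at h
        linarith

lemma Mmat_two_eq_map {n : ℕ} : Mmat n 2 = (MmatInt n).map (Int.castRingHom ℝ) := by
  ext i j
  simp only [Mmat, MmatInt, Matrix.of_apply, Matrix.map_apply]
  split_ifs <;> norm_num

lemma exists_int_of_Mmat_two_charpoly_isRoot {n : ℕ} {x : ℚ}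
    (h : (Mmat n 2).charpoly.IsRoot (x : ℝ)) : ∃ z : ℤ, (z : ℚ) = x := by
  rw [Mmat_two_eq_map, Matrix.charpoly_map, IsRoot, eval_map] at h
  have hx : aeval x (MmatInt n).charpoly = 0 := by
    apply (algebraMap ℚ ℝ).injective
    rw [← aeval_algebraMap_apply, map_zero]
    exact h
  exact isInteger_of_is_root_of_monic (Matrix.charpoly_monic _) hx

theorem stmt14 (n : ℕ) (hn : 0 < n) (h3 : n % 3 = 1) :
    (Mmat n 2).charpoly.IsRoot 1 ∧
      ∀ x : ℚ, (Mmat n 2).charpoly.IsRoot (x : ℝ) → (x : ℝ) = 1 := by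
  refine ⟨?_, fun x hx => ?_⟩
  · rw [Mmat_charpoly_isRoot_iff hn, show (1 : ℝ) - 2 = ((-1 : ℤ) : ℝ) by norm_num,
      lucasSeq_intCast, lucasSeq_intCast]
    obtain ⟨k, rfl⟩ : ∃ k, n = 3 * k + 1 := ⟨n / 3, by omega⟩
    obtain ⟨h₀, h₁⟩ := lucasSeq_neg_one k
    simp [lucasSeq, h₀, h₁]
  · obtain ⟨z, rfl⟩ := exists_int_of_Mmat_two_charpoly_isRoot hx
    rw [Mmat_charpoly_isRoot_iff hn, show ((z : ℚ) : ℝ) - 2 = ((z - 2 : ℤ) : ℝ) by push_cast; ring,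
      lucasSeq_intCast, lucasSeq_intCast] at hx
    simp [eq_one_of_lucasSeq_add_eq_zero (x := z) (by exact_mod_cast hx)]
end
end
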